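/- Define, for a set partition ρ of [m] and N ∈ ℕ, K_N(ρ) := Σ_{ι ≥ ρ} (-1)^{|ι|-1}(|ι|-1)! ∏_{C∈ι} (1 - 1/N)(1 - 2/N)···(1 - (|C|-1)/N), where the sum runs over partitions ι of [m] coarser than ρ. Then |K_N(ρ)| ≤ m! · N^{1-|ρ|} for all m ≥ 1 and all partitions ρ of [m]. -/

import Mathlib

open Finset

/-- `π` is a set partition of the finite type `α`. -/
def IsPartition {α : Type*} [Fintype α] (π : Finset (Finset α)) : Prop :=
  ∅ ∉ π ∧ ∀ x : α, ∃! B, B ∈ π ∧ x ∈ B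

/-- `π` refines `σ`: every block of `π` is contained in some block of `σ`. -/
def Refines {α : Type*} (π σ : Finset (Finset α)) : Prop :=
  ∀ B ∈ π, ∃ C ∈ σ, B ⊆ C

lemma aux_desc_eval (n : ℕ) :
    (descPochhammer ℤ n).eval (-1) = (-1) ^ n * (n.factorial : ℤ) := by
  induction n with
  | zero => simp
  | succ n ih =>
    rw [descPochhammer_succ_right, Polynomial.eval_mul, ih]
    simp [Nat.factorial_succ]
    ring

lemma aux_desc_coeff (n : ℕ) (hn : 1 ≤ n) :
    (descPochhammer ℤ n).coeff 1 = (-1) ^ (n - 1) * ((n - 1).factorial : ℤ) := by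
  obtain ⟨k, rfl⟩ : ∃ k, n = k + 1 := ⟨n - 1, by omega⟩
  rw [descPochhammer_succ_left, Polynomial.coeff_X_mul, Polynomial.coeff_zero_eq_eval_zero,
    Polynomial.eval_comp]
  simp [aux_desc_eval]

lemma aux_prod_rank {m : ℕ} (F : ℕ → ℝ) (C : Finset (Fin m)) :
    ∏ i ∈ C, F (#{j ∈ C | j < i}) = ∏ i ∈ range (#C), F i := by
  classical
  induction C using Finset.induction_on_max with
  | empty => simp
  | insert a s h ih =>
    have ha : a ∉ s := fun h' => lt_irrefl _ (h a h')
    rw [Finset.prod_insert ha, Finset.card_insert_of_notMem ha, Finset.prod_range_succ, ← ih,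
      mul_comm]
    congr 1
    · refine Finset.prod_congr rfl fun i hi => ?_
      rw [Finset.filter_insert, if_neg (not_lt.2 (h i hi).le)]
    · rw [Finset.filter_insert, if_neg (lt_irrefl _), Finset.filter_true_of_mem h]

/-- same block -/
def auxR {m : ℕ} (ι : Finset (Finset (Fin m))) (i j : Fin m) : Prop := ∃ C ∈ ι, i ∈ C ∧ j ∈ C

lemma auxR_iff {m : ℕ} {ι : Finset (Finset (Fin m))} (hι : IsPartition ι) {C : Finset (Fin m)}
    (hC : C ∈ ι) {i : Fin m} (hi : i ∈ C) (j : Fin m) : auxR ι i j ↔ j ∈ C := by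
  constructor
  · rintro ⟨D, hD, hiD, hjD⟩
    rwa [(hι.2 i).unique ⟨hC, hi⟩ ⟨hD, hiD⟩]
  · exact fun h => ⟨C, hC, hi, h⟩

/-- edge weight -/
noncomputable def auxw {m : ℕ} (N : ℕ) (i j : Fin m) : ℝ := if j = i then 1 else -(1 / (N : ℝ))

lemma aux_prod_expand {m : ℕ} (N : ℕ) (ι : Finset (Finset (Fin m))) (hι : IsPartition ι) :
    ∏ C ∈ ι, ∏ i ∈ Finset.range (C.card - 1), (1 - ((i : ℝ) + 1) / (N : ℝ)) =
    by classical exact ∑ a ∈ (Fintype.piFinset fun i : Fin m => Finset.Iic i) with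
      (∀ i, auxR ι i (a i)), ∏ i, auxw N i (a i) := by
  classical
  have h1 : ∀ C ∈ ι, ∏ i ∈ Finset.range (C.card - 1), (1 - ((i : ℝ) + 1) / (N : ℝ)) =
      ∏ i ∈ C, ∑ j ∈ Finset.Iic i with auxR ι i j, auxw N i j := by
    intro C hC
    have hne : C.Nonempty := by
      rw [Finset.nonempty_iff_ne_empty]; rintro rfl; exact hι.1 hC
    have : ∀ i ∈ C, ∑ j ∈ Finset.Iic i with auxR ι i j, auxw N i j =
        (fun n : ℕ => 1 - (n : ℝ) / N) (#{j ∈ C | j < i}) := by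
      intro i hi
      have e : (Finset.Iic i).filter (auxR ι i) = insert i (C.filter (· < i)) := by
        ext j
        simp only [Finset.mem_filter, Finset.mem_Iic, auxR_iff hι hC hi, Finset.mem_insert]
        constructor
        · rintro ⟨h, h'⟩
          rcases h.eq_or_lt with h | h
          · exact Or.inl h
          · exact Or.inr ⟨h', h⟩
        · rintro (rfl | ⟨h, h'⟩)
          · exact ⟨le_rfl, hi⟩
          · exact ⟨h'.le, h⟩
      rw [e, Finset.sum_insert (by simp)]
      rw [Finset.sum_congr rfl (g := fun _ => -(1 / (N : ℝ)))]
      · simp [auxw]; ring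
      · intro j hj
        simp only [Finset.mem_filter] at hj
        simp [auxw, hj.2.ne]
    rw [Finset.prod_congr rfl this, aux_prod_rank (fun n : ℕ => 1 - (n : ℝ) / N)]
    obtain ⟨k, hk⟩ : ∃ k, #C = k + 1 := ⟨#C - 1, by have := hne.card_pos; omega⟩
    rw [hk, Finset.prod_range_succ']
    simp
  rw [Finset.prod_congr rfl h1]
  have h2 : (Finset.univ : Finset (Fin m)) = ι.biUnion id := by
    ext i
    obtain ⟨B, hB, -⟩ := hι.2 i
    simp only [Finset.mem_univ, Finset.mem_biUnion, true_iff]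
    exact ⟨B, hB⟩
  have h3 : ∏ C ∈ ι, ∏ i ∈ C, ∑ j ∈ Finset.Iic i with auxR ι i j, auxw N i j =
      ∏ i, ∑ j ∈ Finset.Iic i with auxR ι i j, auxw N i j := by
    rw [h2, Finset.prod_biUnion]
    · rfl
    · intro C hC D hD hne
      refine Finset.disjoint_left.2 fun i hi hi' => hne ?_
      exact (hι.2 i).unique ⟨hC, hi⟩ ⟨hD, hi'⟩
  rw [h3, Finset.prod_univ_sum]
  refine Finset.sum_congr ?_ fun _ _ => rfl
  ext a
  simp [Fintype.mem_piFinset, forall_and]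

/-- kernel partition of `g` -/
def auxKer {m x : ℕ} (g : Fin m → Fin x) : Finset (Finset (Fin m)) :=
  Finset.univ.image fun i => Finset.univ.filter fun j => g j = g i

lemma auxKer_part {m x : ℕ} (g : Fin m → Fin x) : IsPartition (auxKer g) := by
  refine ⟨?_, fun i => ⟨Finset.univ.filter fun j => g j = g i, ?_, ?_⟩⟩
  · simp only [auxKer, Finset.mem_image, not_exists, not_and]
    intro i _ h
    have : i ∈ (∅ : Finset (Fin m)) := by rw [← h]; simp
    simp at this
  · simp [auxKer]
  · rintro B ⟨hB, hi⟩
    simp only [auxKer, Finset.mem_image] at hB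
    obtain ⟨k, -, rfl⟩ := hB
    simp only [Finset.mem_filter, Finset.mem_univ, true_and] at hi
    rw [hi]

lemma auxR_ker {m x : ℕ} (g : Fin m → Fin x) (i j : Fin m) :
    auxR (auxKer g) i j ↔ g i = g j := by
  rw [auxR_iff (auxKer_part g) (C := Finset.univ.filter fun j => g j = g i)
    (by simp [auxKer]) (by simp)]
  simp [eq_comm]

lemma aux_part_ext {m : ℕ} {ι κ : Finset (Finset (Fin m))} (hι : IsPartition ι)
    (hκ : IsPartition κ) (h : ∀ i j, auxR ι i j ↔ auxR κ i j) : ι = κ := by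
  have key : ∀ {ι κ : Finset (Finset (Fin m))}, IsPartition ι → IsPartition κ →
      (∀ i j, auxR ι i j ↔ auxR κ i j) → ι ⊆ κ := by
    intro ι κ hι hκ h C hC
    obtain ⟨i, hi⟩ : C.Nonempty := by
      rw [Finset.nonempty_iff_ne_empty]; rintro rfl; exact hι.1 hC
    obtain ⟨D, ⟨hD, hiD⟩, -⟩ := hκ.2 i
    have : C = D := by
      ext j
      rw [← auxR_iff hι hC hi, ← auxR_iff hκ hD hiD, h]
    rwa [this]
  exact Finset.Subset.antisymm (key hι hκ h) (key hκ hι fun i j => (h i j).symm)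

lemma aux_count {m x : ℕ} (ι : Finset (Finset (Fin m))) (hι : IsPartition ι) :
    #{g : Fin m → Fin x | auxKer g = ι} = x.descFactorial (#ι) := by
  classical
  have : x.descFactorial (#ι) = Fintype.card (ι ↪ Fin x) := by
    rw [Fintype.card_embedding_eq]; simp
  rw [this, ← Finset.card_univ]
  symm
  choose b hb hb' using hι.2
  have hbC : ∀ C ∈ ι, ∀ i ∈ C, b i = C := fun C hC i hi => (hb' i C ⟨hC, hi⟩).symm
  refine Finset.card_bij (fun e _ i => e ⟨b i, (hb i).1⟩) ?_ ?_ ?_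
  · intro e _
    simp only [Finset.mem_filter, Finset.mem_univ, true_and]
    refine aux_part_ext (auxKer_part _) hι fun i j => ?_
    rw [auxR_ker, auxR_iff hι (hb i).1 (hb i).2, e.injective.eq_iff, Subtype.mk.injEq]
    constructor
    · intro h; rw [h]; exact (hb j).2
    · intro h; exact (hbC _ (hb i).1 _ h).symm
  · intro e _ e' _ h
    ext ⟨C, hC⟩
    obtain ⟨i, hi⟩ : C.Nonempty := by
      rw [Finset.nonempty_iff_ne_empty]; rintro rfl; exact hι.1 hC
    have := congrFun h i
    simp only [hbC C hC i hi] at this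
    rw [this]
  · intro g hg
    simp only [Finset.mem_filter, Finset.mem_univ, true_and] at hg
    have hne : ∀ C : ι, ∃ i, i ∈ C.1 := by
      rintro ⟨C, hC⟩
      change C.Nonempty
      rw [Finset.nonempty_iff_ne_empty]; rintro rfl; exact hι.1 hC
    choose p hp using hne
    have hR : ∀ i j, g i = g j ↔ auxR ι i j := fun i j => by rw [← hg, auxR_ker]
    refine ⟨⟨fun C => g (p C), ?_⟩, Finset.mem_univ _, ?_⟩
    · intro C D h
      simp only [hR] at h
      rw [auxR_iff hι C.2 (hp C)] at h
      exact Subtype.ext ((hι.2 _).unique ⟨C.2, h⟩ ⟨D.2, hp D⟩)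
    · funext i
      change g (p _) = g i
      rw [hR]
      exact ⟨b i, (hb i).1, hp ⟨b i, (hb i).1⟩, (hb i).2⟩

lemma aux_refines_iff {m : ℕ} {ρ ι : Finset (Finset (Fin m))} (hρ : IsPartition ρ)
    (hι : IsPartition ι) : Refines ρ ι ↔ ∀ i j, auxR ρ i j → auxR ι i j := by
  constructor
  · rintro h i j ⟨B, hB, hi, hj⟩
    obtain ⟨C, hC, hBC⟩ := h B hB
    exact ⟨C, hC, hBC hi, hBC hj⟩
  · intro h B hB
    obtain ⟨i, hi⟩ : B.Nonempty := by
      rw [Finset.nonempty_iff_ne_empty]; rintro rfl; exact hρ.1 hB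
    obtain ⟨C, ⟨hC, hiC⟩, -⟩ := hι.2 i
    refine ⟨C, hC, fun j hj => ?_⟩
    exact (auxR_iff hι hC hiC j).1 (h i j ⟨B, hB, hi, hj⟩)

open Classical in
lemma aux_sum_desc {m : ℕ} (r : Fin m → Fin m → Prop) :
    ∑ ι : Finset (Finset (Fin m)) with (IsPartition ι ∧ ∀ i j, r i j → auxR ι i j),
      descPochhammer ℤ (#ι) = Polynomial.X ^ (Nat.card (Quot r)) := by
  apply Polynomial.eq_of_infinite_eval_eq
  refine Set.Infinite.mono ?_ (Set.infinite_range_of_injective (Nat.cast_injective (R := ℤ)))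
  rintro _ ⟨x, rfl⟩
  simp only [Set.mem_ofPred_eq, Polynomial.eval_finsetSum, Polynomial.eval_pow, Polynomial.eval_X,
    descPochhammer_eval_eq_descFactorial]
  norm_cast
  have h1 : x ^ Nat.card (Quot r) = #{g : Fin m → Fin x | ∀ i j, r i j → g i = g j} := by
    have e : (Quot r → Fin x) ≃ {g : Fin m → Fin x // ∀ i j, r i j → g i = g j} :=
      { toFun := fun f => ⟨fun i => f (Quot.mk r i), fun i j h => congrArg f (Quot.sound h)⟩
        invFun := fun g => Quot.lift g.1 g.2
        left_inv := fun f => by funext q; induction q using Quot.ind; rfl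
        right_inv := fun g => rfl }
    have := Nat.card_congr e
    rw [Nat.card_fun, Nat.card_fin] at this
    rw [this, Nat.card_eq_fintype_card, Fintype.card_subtype]
  rw [h1, Finset.card_eq_sum_card_fiberwise (f := auxKer)
    (t := Finset.univ.filter fun ι : Finset (Finset (Fin m)) =>
      IsPartition ι ∧ ∀ i j, r i j → auxR ι i j)]
  · refine Finset.sum_congr rfl fun ι hι => ?_
    simp only [Finset.mem_filter, Finset.mem_univ, true_and] at hι
    rw [← aux_count ι hι.1, Finset.filter_filter]
    congr 1
    ext g
    simp only [Finset.mem_filter, Finset.mem_univ, true_and]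
    constructor
    · rintro rfl
      exact ⟨fun i j h => (auxR_ker g i j).1 (hι.2 i j h), rfl⟩
    · exact fun h => h.2
  · intro g hg
    simp only [Finset.coe_filter, Finset.mem_univ, true_and, Set.mem_ofPred_eq] at hg ⊢
    exact ⟨auxKer_part g, fun i j h => (auxR_ker g i j).2 (hg i j h)⟩

/-- generated relation -/
def auxr {m : ℕ} (ρ : Finset (Finset (Fin m))) (a : Fin m → Fin m) (i j : Fin m) : Prop :=
  auxR ρ i j ∨ j = a i

open Classical in
lemma aux_rank {m : ℕ} (hm : 1 ≤ m) (ρ : Finset (Finset (Fin m))) (hρ : IsPartition ρ)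
    (a : Fin m → Fin m) (h : Nat.card (Quot (auxr ρ a)) = 1) :
    #ρ ≤ #{i | a i ≠ i} + 1 := by
  choose b hb hb' using hρ.2
  have hbC : ∀ C ∈ ρ, ∀ i ∈ C, b i = C := fun C hC i hi => (hb' i C ⟨hC, hi⟩).symm
  let β : Fin m → ρ := fun i => ⟨b i, (hb i).1⟩
  have hβ : ∀ C : ρ, ∃ i, β i = C := by
    rintro ⟨C, hC⟩
    obtain ⟨i, hi⟩ : C.Nonempty := by
      rw [Finset.nonempty_iff_ne_empty]; rintro rfl; exact hρ.1 hC
    exact ⟨i, Subtype.ext (hbC C hC i hi)⟩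
  let G : SimpleGraph ρ := SimpleGraph.fromRel fun C D => ∃ i, β i = C ∧ β (a i) = D
  have hreach : ∀ i j, auxr ρ a i j → G.Reachable (β i) (β j) := by
    rintro i j (⟨C, hC, hi, hj⟩ | rfl)
    · have : β i = β j := Subtype.ext ((hbC C hC i hi).trans (hbC C hC j hj).symm)
      rw [this]
    · by_cases h : β i = β (a i)
      · rw [← h]
      · exact SimpleGraph.Adj.reachable ((SimpleGraph.fromRel_adj _ _ _).2
          ⟨h, Or.inl ⟨i, rfl, rfl⟩⟩)
  have hall : ∀ i j, G.Reachable (β i) (β j) := by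
    intro i j
    have hs : Subsingleton (Quot (auxr ρ a)) := (Nat.card_eq_one_iff_unique.1 h).1
    have hq : Quot.mk (auxr ρ a) i = Quot.mk _ j := Subsingleton.elim _ _
    have := Quot.eqvGen_exact hq
    induction this with
    | rel i j h => exact hreach i j h
    | refl i => exact SimpleGraph.Reachable.refl _
    | symm i j _ ih => exact (ih (Subsingleton.elim _ _)).symm
    | trans i j k _ _ ih ih' =>
      exact (ih (Subsingleton.elim _ _)).trans (ih' (Subsingleton.elim _ _))
  have hconn : G.Connected := by
    have : Nonempty ρ := ⟨β ⟨0, hm⟩⟩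
    refine ⟨fun C D => ?_⟩
    obtain ⟨i, rfl⟩ := hβ C
    obtain ⟨j, rfl⟩ := hβ D
    exact hall i j
  have hle := hconn.card_vert_le_card_edgeSet_add_one
  have hsub : G.edgeSet ⊆ ((Finset.univ.filter fun i => a i ≠ i).image
      fun i => s(β i, β (a i)) : Finset (Sym2 ρ)) := by
    intro e
    induction e using Sym2.ind with
    | _ C D =>
    rw [SimpleGraph.mem_edgeSet, SimpleGraph.fromRel_adj]
    rintro ⟨hne, ⟨i, rfl, rfl⟩ | ⟨i, rfl, rfl⟩⟩
    · simp only [Finset.coe_image, Set.mem_image]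
      refine ⟨i, ?_, rfl⟩
      simp only [Finset.coe_filter, Finset.mem_univ, true_and, Set.mem_ofPred_eq]
      intro h; exact hne (by rw [h])
    · simp only [Finset.coe_image, Set.mem_image]
      refine ⟨i, ?_, Sym2.eq_swap⟩
      simp only [Finset.coe_filter, Finset.mem_univ, true_and, Set.mem_ofPred_eq]
      intro h; exact hne (by rw [h])
  have h2 : Nat.card G.edgeSet ≤ #{i | a i ≠ i} := by
    have := Nat.card_mono (Finset.finite_toSet _) hsub
    refine this.trans ?_
    rw [Nat.card_eq_card_toFinset, Finset.toFinset_coe]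
    exact Finset.card_image_le
  have h3 : Nat.card ρ = #ρ := by simp
  omega

open Classical in
lemma aux_inner {m : ℕ} (hm : 1 ≤ m) (ρ : Finset (Finset (Fin m))) (hρ : IsPartition ρ)
    (a : Fin m → Fin m) :
    ∑ ι : Finset (Finset (Fin m)) with ((IsPartition ι ∧ Refines ρ ι) ∧ ∀ i, auxR ι i (a i)),
      ((-1 : ℝ) ^ (ι.card - 1) * ((ι.card - 1).factorial : ℝ)) =
      if Nat.card (Quot (auxr ρ a)) = 1 then 1 else 0 := by
  have h := congrArg (fun p => ((p.coeff 1 : ℤ) : ℝ)) (aux_sum_desc (auxr ρ a))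
  simp only [Polynomial.finsetSum_coeff, Polynomial.coeff_X_pow] at h
  push_cast at h
  simp only [eq_comm (a := 1)] at h
  rw [← h]
  have hs : (Finset.univ.filter fun ι : Finset (Finset (Fin m)) =>
      ((IsPartition ι ∧ Refines ρ ι) ∧ ∀ i, auxR ι i (a i))) =
      (Finset.univ.filter fun ι : Finset (Finset (Fin m)) =>
      (IsPartition ι ∧ ∀ i j, auxr ρ a i j → auxR ι i j)) := by
    ext ι
    simp only [Finset.mem_filter, Finset.mem_univ, true_and, and_assoc]
    refine and_congr_right fun hι => ?_
    rw [aux_refines_iff hρ hι]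
    constructor
    · rintro ⟨h1, h2⟩ i j (h | rfl)
      · exact h1 i j h
      · exact h2 i
    · intro h
      exact ⟨fun i j h' => h i j (Or.inl h'), fun i => h i _ (Or.inr rfl)⟩
  rw [hs]
  refine Finset.sum_congr rfl fun ι hι => ?_
  simp only [Finset.mem_filter, Finset.mem_univ, true_and] at hι
  obtain ⟨B, ⟨hB, -⟩, -⟩ := hι.1.2 ⟨0, hm⟩
  rw [aux_desc_coeff _ (Finset.card_pos.2 ⟨B, hB⟩)]
  push_cast
  rfl

/-- For a set partition `ρ` of `[m]` and `N ≥ 1`,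
`K_N(ρ) := Σ_{ι ≥ ρ} (-1)^{|ι|-1}(|ι|-1)! ∏_{C∈ι} (1-1/N)⋯(1-(|C|-1)/N)`
satisfies `|K_N(ρ)| ≤ m! · N^{1-|ρ|}`. -/
theorem stmt16 (m N : ℕ) (hm : 1 ≤ m) (hN : 1 ≤ N)
    (ρ : Finset (Finset (Fin m))) (hρ : IsPartition ρ) :
    |∑ ι ∈ @Finset.filter _ (fun ι => IsPartition ι ∧ Refines ρ ι)
        (Classical.decPred _) Finset.univ,
      ((-1 : ℝ) ^ (ι.card - 1) * ((ι.card - 1).factorial : ℝ) *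
        ∏ C ∈ ι, ∏ i ∈ Finset.range (C.card - 1), (1 - ((i : ℝ) + 1) / (N : ℝ)))|
      ≤ (m.factorial : ℝ) * (N : ℝ) ^ ((1 : ℤ) - (ρ.card : ℤ)) := by
  classical
  have e1 : ∑ ι ∈ @Finset.filter _ (fun ι => IsPartition ι ∧ Refines ρ ι)
        (Classical.decPred _) Finset.univ,
      ((-1 : ℝ) ^ (ι.card - 1) * ((ι.card - 1).factorial : ℝ) *
        ∏ C ∈ ι, ∏ i ∈ Finset.range (C.card - 1), (1 - ((i : ℝ) + 1) / (N : ℝ))) =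
      ∑ a ∈ Fintype.piFinset fun i : Fin m => Finset.Iic i,
        (∏ i, auxw N i (a i)) * if Nat.card (Quot (auxr ρ a)) = 1 then 1 else 0 := by
    have : ∀ ι ∈ @Finset.filter _ (fun ι => IsPartition ι ∧ Refines ρ ι)
        (Classical.decPred _) Finset.univ,
        ((-1 : ℝ) ^ (ι.card - 1) * ((ι.card - 1).factorial : ℝ) *
        ∏ C ∈ ι, ∏ i ∈ Finset.range (C.card - 1), (1 - ((i : ℝ) + 1) / (N : ℝ))) =
        ∑ a ∈ Fintype.piFinset fun i : Fin m => Finset.Iic i,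
          if (∀ i, auxR ι i (a i)) then (∏ i, auxw N i (a i)) *
            ((-1 : ℝ) ^ (ι.card - 1) * ((ι.card - 1).factorial : ℝ)) else 0 := by
      intro ι hι
      rw [aux_prod_expand N ι ((@Finset.mem_filter _ _ (Classical.decPred _) _ _).1 hι).2.1, mul_comm, Finset.sum_mul,
        Finset.sum_filter]
    rw [Finset.sum_congr rfl this, Finset.sum_comm]
    refine Finset.sum_congr rfl fun a _ => ?_
    rw [← aux_inner hm ρ hρ a, Finset.mul_sum, ← Finset.sum_filter, Finset.filter_filter]
    exact Finset.sum_congr (by congr) fun _ _ => rfl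
  rw [e1]
  have hN' : (1 : ℝ) ≤ N := by exact_mod_cast hN
  have hcard : #(Fintype.piFinset fun i : Fin m => Finset.Iic i) = m.factorial := by
    rw [Fintype.card_piFinset, ← Finset.prod_range_add_one_eq_factorial,
      ← Fin.prod_univ_eq_prod_range (fun i => i + 1)]
    simp
  refine (Finset.abs_sum_le_sum_abs _ _).trans ?_
  rw [← hcard, ← nsmul_eq_mul]
  refine Finset.sum_le_card_nsmul _ _ _ fun a _ => ?_
  split_ifs with h
  · have hr := aux_rank hm ρ hρ a h
    have hw : |∏ i, auxw N i (a i)| = (N : ℝ) ^ (-(#{i | a i ≠ i} : ℤ)) := by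
      rw [Finset.abs_prod]
      have : ∀ i, |auxw N i (a i)| = if a i ≠ i then (N : ℝ)⁻¹ else 1 := by
        intro i
        by_cases hi : a i = i <;> simp [auxw, hi]
      simp only [this]
      rw [← Finset.prod_filter, Finset.prod_const, zpow_neg, zpow_natCast, inv_pow]
    rw [mul_one, hw]
    refine zpow_le_zpow_right₀ hN' ?_
    have : (#ρ : ℤ) ≤ #{i | a i ≠ i} + 1 := by exact_mod_cast hr
    linarith
  · simp only [mul_zero, abs_zero]
    positivity
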